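/- Let l ≥ 1, r : Fin l → ℝ, w : Fin l → {0,1} a binary indicator vector whose selected set S = {i : w_i = 1} is nonempty, and take ε = 0. Suppose β > 0 and h > 0 satisfy h·e^{βh} > (l−1)·e^{−1}/β, and suppose max_j (r_j w_j) ≠ 0. Then max_{i∈S} r_i < 0 if and only if F(r,β,h,w) < 0, and max_{i∈S} r_i > 0 if and only if F(r,β,h,w) > 0. -/

import Mathlib

/-- The sparse softmax function `F(r, β, h, w)`: with `r'_i = r_i * w_i`,
`r''_i = h * r'_i / (|max_j r'_j| + ε)` and `q_i = exp (β * r''_i) / ∑_j exp (β * r''_j)`,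
it is `(∑_i r_i * w_i * q_i) / (∑_i w_i * q_i)`. -/
noncomputable def sparseSoftmax {l : ℕ} (r : Fin l → ℝ) (β h ε : ℝ) (w : Fin l → ℝ) : ℝ :=
  let r' : Fin l → ℝ := fun i => r i * w i
  let m : ℝ := ⨆ i, r' i
  let r'' : Fin l → ℝ := fun i => h * r' i / (|m| + ε)
  let q : Fin l → ℝ := fun i => Real.exp (β * r'' i) / ∑ j, Real.exp (β * r'' j)
  (∑ i, r i * w i * q i) / (∑ i, w i * q i)

open Finset in
theorem sparseSoftmax_eq_weighted {l : ℕ} [Nonempty (Fin l)] (r : Fin l → ℝ) (β h ε : ℝ)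
    (w : Fin l → ℝ) :
    sparseSoftmax r β h ε w =
      (∑ i, r i * w i * Real.exp (β * (h * (r i * w i) / (|⨆ j, r j * w j| + ε)))) /
        ∑ i, w i * Real.exp (β * (h * (r i * w i) / (|⨆ j, r j * w j| + ε))) := by
  have hZ : ∑ j, Real.exp (β * (h * (r j * w j) / (|⨆ j, r j * w j| + ε))) ≠ 0 :=
    (sum_pos (fun _ _ => Real.exp_pos _) univ_nonempty).ne'
  simp only [sparseSoftmax, ← mul_div_assoc, ← sum_div]
  simp only [mul_div_assoc] at hZ ⊢
  exact div_div_div_cancel_right₀ hZ _ _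

theorem neg_exp_neg_one_le_mul_exp (y : ℝ) : -Real.exp (-1) ≤ y * Real.exp y := by
  have h := mul_le_mul_of_nonneg_right (Real.add_one_le_exp (-y - 1)) (Real.exp_pos y).le
  rw [← Real.exp_add, show -y - 1 + y = -1 by ring] at h
  linarith

/-- If the largest entry `m` is positive, the weighted sum with weights `exp (a * x i / m)` is
positive as soon as the term of the largest entry outweighs the lower bound `-m * exp (-1) / a`
for each of the others. -/
theorem sum_mul_exp_pos {l : ℕ} (x : Fin l → ℝ) (k : Fin l) (hk : 0 < x k) {a : ℝ} (ha : 0 < a)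
    (hcond : ((l : ℝ) - 1) * Real.exp (-1) < a * Real.exp a) :
    0 < ∑ i, x i * Real.exp (a * x i / x k) := by
  have hsum : ((l : ℝ) - 1) * -Real.exp (-1) ≤
      ∑ i ∈ Finset.univ.erase k, a * x i / x k * Real.exp (a * x i / x k) := by
    have h := Finset.card_nsmul_le_sum (Finset.univ.erase k) _ _
      fun i _ => neg_exp_neg_one_le_mul_exp (a * x i / x k)
    have hl : 1 ≤ l := k.pos
    simpa [Finset.card_erase_of_mem, Nat.cast_sub hl] using h
  have hpos : 0 < ∑ i, a * x i / x k * Real.exp (a * x i / x k) := by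
    rw [← Finset.add_sum_erase _ _ (Finset.mem_univ k), mul_div_cancel_right₀ _ hk.ne']
    linarith
  have hscale : ∑ i, a * x i / x k * Real.exp (a * x i / x k) =
      a / x k * ∑ i, x i * Real.exp (a * x i / x k) := by
    rw [Finset.mul_sum]
    exact Finset.sum_congr rfl fun i _ => by ring
  rw [hscale] at hpos
  exact pos_of_mul_pos_right hpos (by positivity)

/-- The maximum part of Proposition 1 (soundness of the sparse softmax): with `ε = 0`,
`β > 0`, `h > 0` satisfying `h * exp (β * h) > (l - 1) * exp (-1) / β`, and
`max_j (r_j * w_j) ≠ 0`, the sparse softmax value has the same strict sign as the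
maximum of the selected entries. -/
theorem sparseSoftmax_sound_max (l : ℕ) (hl : 1 ≤ l)
    (r : Fin l → ℝ) (w : Fin l → ℝ) (hw : ∀ i, w i = 0 ∨ w i = 1)
    (hS : ∃ i, w i = 1) (β h : ℝ) (hβ : 0 < β) (hh : 0 < h)
    (hcond : h * Real.exp (β * h) > ((l : ℝ) - 1) * Real.exp (-1) / β)
    (hne : (⨆ j, r j * w j) ≠ 0) :
    (sSup (r '' {i | w i = 1}) < 0 ↔ sparseSoftmax r β h 0 w < 0) ∧
      (0 < sSup (r '' {i | w i = 1}) ↔ 0 < sparseSoftmax r β h 0 w) := by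
  obtain ⟨i₀, hi₀⟩ := hS
  have : Nonempty (Fin l) := ⟨i₀⟩
  obtain ⟨k, hk⟩ := exists_eq_ciSup_of_finite (f := fun j => r j * w j)
  have hle : ∀ i, r i * w i ≤ r k * w k := fun i =>
    hk ▸ le_ciSup (f := fun j => r j * w j) (Set.finite_range _).bddAbove i
  have hwk : w k = 1 := (hw k).resolve_left fun h0 => hne (by rw [← hk, h0, mul_zero])
  have hmax : IsGreatest (r '' {i | w i = 1}) (r k) := by
    refine ⟨⟨k, hwk, rfl⟩, ?_⟩
    rintro _ ⟨i, hi, rfl⟩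
    have hi' : w i = 1 := hi
    simpa [hi', hwk] using hle i
  have hw0 : ∀ i, 0 ≤ w i := fun i => by rcases hw i with h | h <;> simp [h]
  have hden : 0 < ∑ i, w i * Real.exp (β * (h * (r i * w i) / (|r k * w k| + 0))) :=
    Finset.sum_pos' (fun i _ => mul_nonneg (hw0 i) (Real.exp_pos _).le)
      ⟨k, Finset.mem_univ k, by rw [hwk, one_mul]; exact Real.exp_pos _⟩
  rw [hmax.csSup_eq, sparseSoftmax_eq_weighted, ← hk]
  rw [← hk] at hne
  have hxk : r k * w k = r k := by rw [hwk, mul_one]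
  rcases lt_or_gt_of_ne hne with hneg | hpos
  · have hF : (∑ i, r i * w i * Real.exp (β * (h * (r i * w i) / (|r k * w k| + 0)))) /
        ∑ i, w i * Real.exp (β * (h * (r i * w i) / (|r k * w k| + 0))) < 0 :=
      div_neg_of_neg_of_pos (Finset.sum_neg (fun i _ =>
        mul_neg_of_neg_of_pos ((hle i).trans_lt hneg) (Real.exp_pos _)) Finset.univ_nonempty) hden
    have hrk : r k < 0 := hxk ▸ hneg
    exact ⟨iff_of_true hrk hF, iff_of_false hrk.not_gt hF.not_gt⟩
  · have hF : 0 < (∑ i, r i * w i * Real.exp (β * (h * (r i * w i) / (|r k * w k| + 0)))) /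
        ∑ i, w i * Real.exp (β * (h * (r i * w i) / (|r k * w k| + 0))) := by
      refine div_pos ?_ hden
      have hc : ((l : ℝ) - 1) * Real.exp (-1) < β * h * Real.exp (β * h) := by
        rw [gt_iff_lt, div_lt_iff₀ hβ] at hcond
        linarith
      simpa only [add_zero, abs_of_pos hpos, mul_assoc, mul_div_assoc] using
        sum_mul_exp_pos (fun i => r i * w i) k hpos (mul_pos hβ hh) hc
    have hrk : 0 < r k := hxk ▸ hpos
    exact ⟨iff_of_false hrk.not_gt hF.not_gt, iff_of_true hrk hF⟩
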